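/- In a vertex algebra, the symmetry X_{z1,z2}(a⊗b) = X_{z2,z1}(b⊗a) together with the expansion identities implies skew-symmetry of vertex operators: Y(a,z)b = e^{zD} Y(b,−z) a, as an identity in V((z)). -/

import Mathlib

/- Vertex algebra setup (coefficient formulation).
V is a ℂ-vector space with translation operator D and vacuum `vac`; the vertex
operators are given by their coefficients: `Y a b n` = coefficient of z^n in Y(a,z)b.
Axioms used as hypotheses:
 * field/truncation: `Y a b n = 0` for `n < -(Nf a b)`;
 * vacuum: `Y(1,z) = id` and `Y(a,z)1 = e^{zD}a` (coefficients `expCoeff D a n`);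
 * translation covariance: `[D,Y(a,z)] = ∂_z Y(a,z)`, coefficientwise
   `D (Y a b n) − Y a (D b) n = (n+1) • Y a b (n+1)`;
 * weak commutativity: for all a,b there is N with (z1−z2)^N [Y(a,z1),Y(b,z2)] = 0,
   stated coefficientwise using the binomial expansion of (z1−z2)^N.

X_{z1,z2}(a⊗b) := e^{z2 D} Y(a, z1−z2) b ∈ V[[z1,z2]][(z1−z2)^{-1}].  Elements of
that ring are faithfully represented by their expansions into formal distributions
(the expansion maps are injective), so identities in it are stated as identities of
expansion coefficients.
 * `X1coeff D Y a b m n` = coefficient of z1^m z2^n of i_{z1;z2} X_{z1,z2}(a⊗b),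
   expanding (z1−z2)^k (k ∈ ℤ) in the region |z1|>|z2| via generalized binomial
   coefficients `intChoose`;
 * `X2coeff D Y a b m n` = coefficient of z1^m z2^n of i_{z2;z1} X_{z1,z2}(a⊗b),
   expanding (z1−z2)^k in |z2|>|z1| (the j-sum over powers of D is finite by the
   truncation axiom; we use `finsum`). -/

noncomputable section
open Finset

noncomputable def expCoeff {V : Type*} [AddCommGroup V] [Module ℂ V]
    (D : Module.End ℂ V) (a : V) (n : ℤ) : V :=
  if 0 ≤ n then ((n.toNat.factorial : ℂ))⁻¹ • (D ^ n.toNat) a else 0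

/-- generalized binomial coefficient `k(k-1)⋯(k-l+1)/l!` for `k : ℤ` -/
noncomputable def intChoose (k : ℤ) (l : ℕ) : ℂ :=
  ((l.factorial : ℂ))⁻¹ * ∏ i ∈ Finset.range l, ((k : ℂ) - (i : ℂ))

/-- coefficient of z1^m z2^n in the |z1|>|z2| expansion of e^{z2 D} Y(a,z1−z2) b -/
noncomputable def X1coeff {V : Type*} [AddCommGroup V] [Module ℂ V]
    (D : Module.End ℂ V) (Y : V → V → ℤ → V) (a b : V) (m n : ℤ) : V :=
  if 0 ≤ n then
    ∑ j ∈ Finset.range (n.toNat + 1),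
      (((j.factorial : ℂ))⁻¹ * (-1 : ℂ) ^ (n.toNat - j) *
        intChoose (m + ((n.toNat - j : ℕ) : ℤ)) (n.toNat - j)) •
        (D ^ j) (Y a b (m + ((n.toNat - j : ℕ) : ℤ)))
  else 0

/-- coefficient of z1^m z2^n in the |z2|>|z1| expansion of e^{z2 D} Y(a,z1−z2) b -/
noncomputable def X2coeff {V : Type*} [AddCommGroup V] [Module ℂ V]
    (D : Module.End ℂ V) (Y : V → V → ℤ → V) (a b : V) (m n : ℤ) : V :=
  if 0 ≤ m then
    ∑ᶠ j : ℕ,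
      (((j.factorial : ℂ))⁻¹ * (-1 : ℂ) ^ (m + n - (j : ℤ)) * (-1 : ℂ) ^ m.toNat *
        intChoose (m + n - (j : ℤ)) m.toNat) •
        (D ^ j) (Y a b (m + n - (j : ℤ)))
  else 0

section Aux
variable {V : Type*} [AddCommGroup V] [Module ℂ V]

/-- multiplication by `z1` -/
def auxS1 : Module.End ℂ (ℤ → ℤ → V) where
  toFun f := fun i j => f (i - 1) j
  map_add' _ _ := rfl
  map_smul' _ _ := rfl

/-- multiplication by `z2` -/
def auxS2 : Module.End ℂ (ℤ → ℤ → V) where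
  toFun f := fun i j => f i (j - 1)
  map_add' _ _ := rfl
  map_smul' _ _ := rfl

/-- derivative in `z1` -/
def auxP1 : Module.End ℂ (ℤ → ℤ → V) where
  toFun f := fun i j => ((i : ℂ) + 1) • f (i + 1) j
  map_add' _ _ := by funext i j; simp
  map_smul' c f := by funext i j; simp [smul_comm c]

/-- derivative in `z2` -/
def auxP2 : Module.End ℂ (ℤ → ℤ → V) where
  toFun f := fun i j => ((j : ℂ) + 1) • f i (j + 1)
  map_add' _ _ := by funext i j; simp
  map_smul' c f := by funext i j; simp [smul_comm c]

/-- `D` applied coefficientwise -/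
def auxD (D : Module.End ℂ V) : Module.End ℂ (ℤ → ℤ → V) where
  toFun f := fun i j => D (f i j)
  map_add' _ _ := by funext i j; simp
  map_smul' c f := by funext i j; simp

/-- multiplication by `z1 - z2` -/
def auxT : Module.End ℂ (ℤ → ℤ → V) := -auxS2 + auxS1

lemma auxT_apply (f : ℤ → ℤ → V) (i j : ℤ) : auxT f i j = f (i - 1) j - f i (j - 1) := by
  simp [auxT, auxS1, auxS2]; abel

lemma auxS2_pow (l : ℕ) (f : ℤ → ℤ → V) (i j : ℤ) : (auxS2 ^ l) f i j = f i (j - l) := by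
  induction l generalizing j with
  | zero => simp
  | succ l ih =>
    rw [pow_succ']
    change (auxS2 ^ l) f i (j - 1) = _
    rw [ih]; congr 1; push_cast; ring

lemma auxS1_pow (l : ℕ) (f : ℤ → ℤ → V) (i j : ℤ) : (auxS1 ^ l) f i j = f (i - l) j := by
  induction l generalizing i with
  | zero => simp
  | succ l ih =>
    rw [pow_succ']
    change (auxS1 ^ l) f (i - 1) j = _
    rw [ih]; congr 1; push_cast; ring

lemma auxT_pow (N : ℕ) (f : ℤ → ℤ → V) (m n : ℤ) :
    (auxT ^ N) f m n = ∑ l ∈ Finset.range (N + 1), ((-1 : ℂ) ^ l * (N.choose l : ℂ)) •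
        f (m - ((N - l : ℕ) : ℤ)) (n - (l : ℤ)) := by
  have hc : Commute (-auxS2 : Module.End ℂ (ℤ → ℤ → V)) auxS1 := by
    apply LinearMap.ext; intro f; rfl
  rw [auxT, hc.add_pow, LinearMap.sum_apply, Finset.sum_apply, Finset.sum_apply]
  refine Finset.sum_congr rfl fun l _ => ?_
  have h1 : (-auxS2 : Module.End ℂ (ℤ → ℤ → V)) ^ l = ((-1 : ℂ) ^ l) • auxS2 ^ l := by
    rw [← smul_pow]; simp
  have h2 : ((N.choose l : ℕ) : Module.End ℂ (ℤ → ℤ → V)) = (N.choose l : ℂ) • 1 := by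
    apply LinearMap.ext; intro f; simp [Nat.cast_smul_eq_nsmul]
  rw [h1, h2]
  simp only [Algebra.mul_smul_comm, mul_one, Algebra.smul_mul_assoc, LinearMap.smul_apply,
    Pi.smul_apply, Module.End.mul_apply, auxS2_pow, auxS1_pow, smul_smul]
  rw [mul_comm]

lemma auxP2_T (f : ℤ → ℤ → V) : auxT (auxP2 f) = auxP2 (auxT f) + f := by
  funext i j
  simp only [Pi.add_apply, auxT_apply]
  simp only [auxP2, LinearMap.coe_mk, AddHom.coe_mk, auxT_apply]
  push_cast
  simp only [add_sub_cancel_right, sub_add_cancel]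
  module

lemma auxP1_T (f : ℤ → ℤ → V) : auxT (auxP1 f) = auxP1 (auxT f) - f := by
  funext i j
  simp only [Pi.sub_apply, auxT_apply]
  simp only [auxP1, LinearMap.coe_mk, AddHom.coe_mk, auxT_apply]
  push_cast
  simp only [add_sub_cancel_right, sub_add_cancel]
  module

lemma auxD_T (D : Module.End ℂ V) (f : ℤ → ℤ → V) : auxT (auxD D f) = auxD D (auxT f) := by
  funext i j
  simp [auxT_apply, auxD]

lemma auxT_tors_P2 (N : ℕ) (f : ℤ → ℤ → V) (h : (auxT ^ N) f = 0) :
    (auxT ^ (N + 1)) (auxP2 f) = 0 := by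
  induction N generalizing f with
  | zero =>
    have : f = 0 := by simpa using h
    simp [this]
  | succ N ih =>
    rw [pow_succ, Module.End.mul_apply, auxP2_T, map_add, h, add_zero]
    apply ih
    rwa [pow_succ] at h

lemma auxT_tors_D (D : Module.End ℂ V) (N : ℕ) (f : ℤ → ℤ → V) (h : (auxT ^ N) f = 0) :
    (auxT ^ N) (auxD D f) = 0 := by
  induction N generalizing f with
  | zero =>
    have : f = 0 := by simpa using h
    simp [this]
  | succ N ih =>
    rw [pow_succ, Module.End.mul_apply, auxD_T]
    apply ih
    rwa [pow_succ] at h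

lemma auxT_mono {N M : ℕ} (hNM : N ≤ M) (f : ℤ → ℤ → V) (h : (auxT ^ N) f = 0) :
    (auxT ^ M) f = 0 := by
  obtain ⟨k, rfl⟩ := Nat.exists_eq_add_of_le' hNM
  rw [pow_add, Module.End.mul_apply, h, map_zero]

lemma auxT_inj (N : ℕ) (f : ℤ → ℤ → V) (hs : ∀ i j, j < 0 → f i j = 0)
    (h : (auxT ^ N) f = 0) : f = 0 := by
  induction N generalizing f with
  | zero => simpa using h
  | succ N ih =>
    have h1 : auxT f = 0 := by
      apply ih
      · intro i j hj
        rw [auxT_apply, hs _ _ hj, hs _ _ (by omega), sub_zero]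
      · rwa [pow_succ] at h
    have key : ∀ k : ℕ, ∀ i, f i (k : ℤ) = 0 := by
      intro k
      induction k with
      | zero =>
        intro i
        have := congrFun (congrFun h1 (i + 1)) 0
        rw [auxT_apply, hs (i + 1) (0 - 1) (by omega)] at this
        simpa using this
      | succ k ihk =>
        intro i
        have := congrFun (congrFun h1 (i + 1)) ((k + 1 : ℕ) : ℤ)
        rw [auxT_apply] at this
        push_cast at this
        simp only [add_sub_cancel_right, ihk] at this
        simpa using this
    funext i j
    rcases lt_or_ge j 0 with hj | hj
    · exact hs i j hj
    · lift j to ℕ using hj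
      exact key j i

lemma auxSkew (D : Module.End ℂ V) (C : ℕ → ℕ → V)
    (hC : ∀ i j, D (C i j) = ((i : ℂ) + 1) • C (i + 1) j + ((j : ℂ) + 1) • C i (j + 1)) (n j : ℕ) :
    ((n.factorial : ℂ) * j.factorial) • C n j = ∑ l ∈ Finset.range (n + 1),
      ((-1 : ℂ) ^ (n - l) * (n.choose l : ℂ) * ((j + (n - l)).factorial : ℂ)) •
        (D ^ l) (C 0 (j + (n - l))) := by
  let S : Module.End ℂ (ℕ → V) :=
    { toFun := fun f j => f (j + 1), map_add' := fun _ _ => rfl, map_smul' := fun _ _ => rfl }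
  let E : Module.End ℂ (ℕ → V) :=
    { toFun := fun f j => D (f j), map_add' := fun _ _ => by funext j; simp,
      map_smul' := fun _ _ => by funext j; simp }
  let F : ℕ → ℕ → V := fun i j => ((i.factorial : ℂ) * j.factorial) • C i j
  have hF : ∀ i, F (i + 1) = (E + -S) (F i) := by
    intro i
    funext j
    change ((((i + 1).factorial : ℕ) : ℂ) * j.factorial) • C (i + 1) j =
      D (((i.factorial : ℂ) * j.factorial) • C i j) +
      -(((i.factorial : ℂ) * ((j + 1).factorial : ℕ)) • C i (j + 1))
    rw [map_smul, hC, Nat.factorial_succ, Nat.factorial_succ]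
    push_cast
    module
  have hFn : ∀ i, F i = ((E + -S) ^ i) (F 0) := by
    intro i
    induction i with
    | zero => simp
    | succ i ih => rw [pow_succ', Module.End.mul_apply, ← ih, hF]
  have hE : ∀ (l : ℕ) (f : ℕ → V) j, (E ^ l) f j = (D ^ l) (f j) := by
    intro l
    induction l with
    | zero => simp
    | succ l ih =>
      intro f j
      rw [pow_succ', pow_succ', Module.End.mul_apply, Module.End.mul_apply, ← ih]; rfl
  have hS : ∀ (l : ℕ) (f : ℕ → V) j, (S ^ l) f j = f (j + l) := by
    intro l
    induction l with
    | zero => simp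
    | succ l ih =>
      intro f j
      rw [pow_succ', Module.End.mul_apply]
      change (S ^ l) f (j + 1) = _
      rw [ih]; congr 1; ring
  have hc : Commute E (-S) := by
    apply LinearMap.ext; intro f; funext j
    change D (-(f (j + 1))) = -D (f (j + 1))
    simp
  have h := congrFun (hFn n) j
  rw [hc.add_pow, LinearMap.sum_apply, Finset.sum_apply] at h
  change F n j = _
  rw [h]
  refine Finset.sum_congr rfl fun l _ => ?_
  have h1 : (-S) ^ (n - l) = ((-1 : ℂ) ^ (n - l)) • S ^ (n - l) := by
    rw [← smul_pow]; simp
  have h2 : ((n.choose l : ℕ) : Module.End ℂ (ℕ → V)) = (n.choose l : ℂ) • 1 := by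
    apply LinearMap.ext; intro f; simp [Nat.cast_smul_eq_nsmul]
  rw [h1, h2]
  simp only [Algebra.mul_smul_comm, mul_one, LinearMap.smul_apply,
    Pi.smul_apply, Module.End.mul_apply, hE, hS, F, map_smul, smul_smul]
  congr 1
  rw [Nat.factorial_zero, Nat.cast_one]; ring

lemma expCoeff_neg (D : Module.End ℂ V) (b : V) (n : ℤ) (hn : n < 0) : expCoeff D b n = 0 := by
  simp [expCoeff, not_le.mpr hn]

lemma expCoeff_zero (D : Module.End ℂ V) (b : V) : expCoeff D b 0 = b := by
  simp [expCoeff]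

lemma expCoeff_D (D : Module.End ℂ V) (b : V) (n : ℤ) :
    expCoeff D (D b) n = D (expCoeff D b n) := by
  unfold expCoeff
  split_ifs
  · rw [map_smul, ← Module.End.mul_apply, ← Module.End.mul_apply, ← pow_succ, ← pow_succ']
  · simp

lemma expCoeff_one (D : Module.End ℂ V) (b : V) : expCoeff D b 1 = D b := by
  simp [expCoeff]

end Aux

/- STATEMENT 17: skew-symmetry Y(a,z)b = e^{zD} Y(b,−z) a in V((z)).
Coefficient of z^k on the right-hand side: e^{zD}Y(b,−z)a
= ∑_j (z^j/j!) D^j ∑_l (−1)^l (Y b a l) z^l, so the coefficient of z^k is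
∑_j (1/j!) (−1)^{k−j} D^j (Y b a (k−j)); the sum over j ∈ ℕ has finite support by
the truncation (field) axiom, so we use `finsum`. -/
theorem stmt17
    {V : Type*} [AddCommGroup V] [Module ℂ V]
    (D : Module.End ℂ V) (vac : V) (Y : V → V → ℤ → V)
    (Nf : V → V → ℕ)
    (hfield : ∀ (a b : V) (n : ℤ), n < -(Nf a b : ℤ) → Y a b n = 0)
    (hvacLeft : ∀ (b : V) (n : ℤ), Y vac b n = if n = 0 then b else 0)
    (hvacRight : ∀ (a : V) (n : ℤ), Y a vac n = expCoeff D a n)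
    (htrans : ∀ (a b : V) (n : ℤ),
      D (Y a b n) - Y a (D b) n = (n + 1) • Y a b (n + 1))
    (hcomm : ∀ a b : V, ∃ N : ℕ, ∀ (c : V) (m n : ℤ),
      ∑ l ∈ Finset.range (N + 1), ((-1 : ℂ) ^ l * (N.choose l : ℂ)) •
        (Y a (Y b c (n - (l : ℤ))) (m - ((N - l : ℕ) : ℤ)) -
         Y b (Y a c (m - ((N - l : ℕ) : ℤ))) (n - (l : ℤ))) = 0)
    :
    ∀ (a b : V) (k : ℤ),
      Y a b k =
        ∑ᶠ j : ℕ, (((j.factorial : ℂ))⁻¹ * (-1 : ℂ) ^ (k - (j : ℤ))) •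
          (D ^ j) (Y b a (k - (j : ℤ))) := by
  intro a b k
  have htr : ∀ (a b : V) (n : ℤ),
      Y a (D b) n = D (Y a b n) - ((n : ℂ) + 1) • Y a b (n + 1) := by
    intro a b n
    have h := htrans a b n
    rw [← Int.cast_smul_eq_zsmul ℂ] at h
    push_cast at h
    rw [← h]; abel
  -- the vacuum is killed by D and Y a 0 = 0
  have hDvac : D vac = 0 := by
    have h := hvacLeft vac 1
    rw [hvacRight, expCoeff_one] at h
    simpa using h
  have hYzero : ∀ (a : V) (n : ℤ), Y a 0 n = 0 := by
    intro a n
    have h0 : Y a 0 n = Y a (D vac) n := by rw [hDvac]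
    rw [h0, htr, hvacRight, hvacRight]
    rcases lt_trichotomy n (-1) with hn | hn | hn
    · rw [expCoeff_neg _ _ _ (by omega), expCoeff_neg _ _ _ (by omega)]; simp
    · subst hn
      rw [expCoeff_neg _ _ _ (by omega)]; simp
    · have h0 : 0 ≤ n := by omega
      lift n to ℕ using h0
      have : ((n : ℤ) + 1) = ((n + 1 : ℕ) : ℤ) := by push_cast; rfl
      rw [this]
      simp only [expCoeff, Int.natCast_nonneg, if_true, Int.toNat_natCast, Nat.factorial_succ]
      rw [map_smul, ← Module.End.mul_apply, ← pow_succ', smul_smul]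
      have h1 : ((n : ℂ) + 1) ≠ 0 := by exact_mod_cast Nat.succ_ne_zero n
      have h2 : (n.factorial : ℂ) ≠ 0 := by exact_mod_cast Nat.factorial_ne_zero n
      rw [sub_eq_zero]
      congr 1
      push_cast
      field_simp
  let A : V → V → ℤ → ℤ → V := fun a b i j => Y a (expCoeff D b j) i
  let B : V → V → ℤ → ℤ → V := fun a b i j => Y b (expCoeff D a i) j
  have hAneg : ∀ a b i j, j < 0 → A a b i j = 0 := by
    intro a b i j hj
    simp only [A, expCoeff_neg _ _ _ hj, hYzero]
  have hBneg : ∀ a b i j, i < 0 → B a b i j = 0 := by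
    intro a b i j hj
    simp only [B, expCoeff_neg _ _ _ hj, hYzero]
  have hloc : ∀ a b, ∃ N : ℕ, (auxT ^ N) (A a b - B a b) = 0 := by
    intro a b
    obtain ⟨N, hN⟩ := hcomm a b
    refine ⟨N, ?_⟩
    funext m n
    rw [auxT_pow]
    have h := hN vac m n
    simp only [hvacRight] at h
    exact h
  have hBD : ∀ a b, B (D a) b = auxD D (B a b) - auxP2 (B a b) := by
    intro a b
    funext i j
    simp only [B, expCoeff_D, htr]
    rfl
  -- (D - ∂2) A_{a,b} = A_{Da,b}
  have hAD : ∀ a b, auxD D (A a b) - auxP2 (A a b) - A (D a) b = 0 := by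
    intro a b
    obtain ⟨N, hN⟩ := hloc a b
    obtain ⟨M, hM⟩ := hloc (D a) b
    apply auxT_inj (N + 1 + M)
    · intro i j hj
      simp only [Pi.sub_apply, hAneg _ _ _ _ hj, sub_zero]
      simp only [auxD, auxP2, LinearMap.coe_mk, AddHom.coe_mk, hAneg _ _ _ _ hj, map_zero, zero_sub]
      rcases eq_or_ne j (-1) with h | h
      · subst h; simp
      · rw [hAneg _ _ _ _ (by omega)]; simp
    · have e : auxD D (A a b) - auxP2 (A a b) - A (D a) b =
          auxD D (A a b - B a b) - auxP2 (A a b - B a b) - (A (D a) b - B (D a) b) := by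
        rw [hBD, map_sub, map_sub]; abel
      rw [e, map_sub, map_sub, auxT_mono (by omega) _ (auxT_tors_P2 N _ hN),
        auxT_mono (by omega) _ (auxT_tors_D D N _ hN), auxT_mono (by omega) _ hM]
      simp
  have hADc : ∀ a b i j, Y (D a) (expCoeff D b j) i =
      D (Y a (expCoeff D b j) i) - ((j : ℂ) + 1) • Y a (expCoeff D b (j + 1)) i := by
    intro a b i j
    have := congrFun (congrFun (hAD a b) i) j
    exact (sub_eq_zero.mp this).symm
  have hDa : ∀ a b i, Y (D a) b i = ((i : ℂ) + 1) • Y a b (i + 1) := by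
    intro a b i
    have h := hADc a b i 0
    rw [expCoeff_zero, zero_add, expCoeff_one, htr] at h
    rw [h]; simp
  have hEA : ∀ a b, auxD D (A a b) = auxP1 (A a b) + auxP2 (A a b) := by
    intro a b
    funext i j
    have h := hADc a b i j
    rw [hDa] at h
    change D (Y a (expCoeff D b j) i) = ((i : ℂ) + 1) • Y a (expCoeff D b j) (i + 1) +
      ((j : ℂ) + 1) • Y a (expCoeff D b (j + 1)) i
    rw [h]; abel
  have hEpow : ∀ (N : ℕ) (f : ℤ → ℤ → V), auxD D f = auxP1 f + auxP2 f →
      auxD D ((auxT ^ N) f) = auxP1 ((auxT ^ N) f) + auxP2 ((auxT ^ N) f) := by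
    intro N
    induction N with
    | zero => intro f hf; simpa using hf
    | succ N ih =>
      intro f hf
      rw [pow_succ, Module.End.mul_apply]
      apply ih
      rw [← auxD_T, hf, map_add, auxP1_T, auxP2_T]; abel
  obtain ⟨N, hN⟩ := hloc a b
  rw [map_sub, sub_eq_zero] at hN
  have hCA0 : ∀ i : ℤ, (auxT ^ N) (A a b) i 0 = Y a b (i - N) := by
    intro i
    rw [auxT_pow, Finset.sum_eq_single 0]
    · simp [A, expCoeff_zero]
    · intro l _ hl
      rw [hAneg _ _ _ _ (by omega), smul_zero]
    · simp
  have hCB0 : ∀ j : ℤ, (auxT ^ N) (A a b) 0 j = (-1 : ℂ) ^ N • Y b a (j - N) := by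
    intro j
    rw [hN, auxT_pow, Finset.sum_eq_single N]
    · simp [B, expCoeff_zero]
    · intro l hl hl'
      rw [Finset.mem_range] at hl
      rw [hBneg _ _ _ _ (by omega), smul_zero]
    · simp
  have hCneg1 : ∀ i j : ℤ, i < 0 → (auxT ^ N) (A a b) i j = 0 := by
    intro i j hi
    rw [hN, auxT_pow]
    refine Finset.sum_eq_zero fun l _ => ?_
    rw [hBneg _ _ _ _ (by omega), smul_zero]
  have hCneg2 : ∀ i j : ℤ, j < 0 → (auxT ^ N) (A a b) i j = 0 := by
    intro i j hi
    rw [auxT_pow]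
    refine Finset.sum_eq_zero fun l _ => ?_
    rw [hAneg _ _ _ _ (by omega), smul_zero]
  have hC := hEpow N _ (hEA a b)
  have hYba : ∀ n : ℤ, n < -(N : ℤ) → Y b a n = 0 := by
    intro n hn
    have h := hCB0 (n + N)
    rw [hCneg2 _ _ (by omega), add_sub_cancel_right] at h
    exact (smul_eq_zero.mp h.symm).resolve_left (by simp)
  have hYab : ∀ n : ℤ, n < -(N : ℤ) → Y a b n = 0 := by
    intro n hn
    have h := hCA0 (n + N)
    rw [hCneg1 _ _ (by omega), add_sub_cancel_right] at h
    exact h.symm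
  rcases lt_or_ge k (-(N : ℤ)) with hk | hk
  · rw [hYab k hk, finsum_eq_zero_of_forall_eq_zero]
    intro j
    rw [hYba _ (by omega)]; simp
  · obtain ⟨n, hn⟩ := Int.eq_ofNat_of_zero_le (show 0 ≤ k + N by omega)
    have hk' : k = (n : ℤ) - N := by omega
    subst hk'
    have hs := auxSkew D (fun i j => (auxT ^ N) (A a b) (i : ℤ) (j : ℤ)) (by
      intro i j
      have h := congrFun (congrFun hC (i : ℤ)) (j : ℤ)
      simpa [auxD, auxP1, auxP2] using h) n 0
    simp only [Nat.cast_zero, hCA0, hCB0, zero_add, Nat.factorial_zero, Nat.cast_one,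
      mul_one] at hs
    have hfn : (n.factorial : ℂ) ≠ 0 := by exact_mod_cast Nat.factorial_ne_zero n
    rw [finsum_eq_sum_of_support_subset (s := Finset.range (n + 1))]
    · apply smul_right_injective V hfn
      dsimp only
      rw [hs, Finset.smul_sum]
      refine Finset.sum_congr rfl fun l hl => ?_
      have hl' : l ≤ n := by rw [Finset.mem_range] at hl; omega
      have e1 : (((n - l : ℕ) : ℤ) - N) = (n : ℤ) - N - l := by omega
      rw [e1, map_smul, smul_smul, smul_smul]
      congr 1
      have e2 : (-1 : ℂ) ^ ((n : ℤ) - N - l) = (-1) ^ (n - l) * (-1) ^ N := by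
        have e3 : ((n : ℤ) - N - l) = ((n - l : ℕ) : ℤ) - (N : ℤ) := by omega
        rw [e3, zpow_sub₀ (by norm_num), zpow_natCast, zpow_natCast, div_eq_mul_inv,
          ← inv_pow]
        norm_num
      rw [e2, ← Nat.choose_mul_factorial_mul_factorial hl']
      have hfl : (l.factorial : ℂ) ≠ 0 := by exact_mod_cast Nat.factorial_ne_zero l
      push_cast
      field_simp
    · intro l hl
      rw [Function.mem_support] at hl
      by_contra h
      apply hl
      have h' : n < l := by simpa using h
      rw [hYba _ (by omega)]; simp

end
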